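/- arXiv:1602.04890 — 10 statements merged into one kernel-verified Lean document; each statement's English description precedes it below -/
import Mathlib

section
/- For every integer m ≥ 1 and every real z with 0 < z < 1, the series ∑_{n≥1} n^m z^n converges and satisfies the lower bound m! · (z/(1−z))^{m+1} ≤ ∑_{n≥1} n^m z^n; if moreover z ≤ 1/2, then also the upper bound ∑_{n≥1} n^m z^n ≤ ((m+1)!/(log 2)^{m+2}) · (z/(1−z)) holds. -/
open Finset in
/-- The series `∑ n ^ m z ^ n` with `m ≥ 1` is `z / (1 - z)` times a binomial combination of the
series with smaller exponents. -/
lemma tsum_pow_mul_geometric_recurrence {m : ℕ} (hm : m ≠ 0) {z : ℝ} (hz0 : 0 < z) (hz1 : z < 1) :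
    ∑' n : ℕ, (n : ℝ) ^ m * z ^ n =
      z / (1 - z) * ∑ j ∈ range m, (m.choose j : ℝ) * ∑' n : ℕ, (n : ℝ) ^ j * z ^ n := by
  have hsum (k : ℕ) : Summable (fun n : ℕ => (n : ℝ) ^ k * z ^ n) :=
    summable_pow_mul_geometric_of_norm_lt_one k (by rwa [Real.norm_of_nonneg hz0.le])
  have hshift : ∑' n : ℕ, (n : ℝ) ^ m * z ^ n =
      z * ∑ j ∈ range (m + 1), (m.choose j : ℝ) * ∑' n : ℕ, (n : ℝ) ^ j * z ^ n := by
    rw [(hsum m).tsum_eq_zero_add]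
    simp_rw [← tsum_mul_left]
    rw [← Summable.tsum_finsetSum fun j _ => (hsum j).mul_left _, ← tsum_mul_left]
    simp only [Nat.cast_zero, zero_pow hm, zero_mul, zero_add]
    refine tsum_congr fun n => ?_
    rw [Nat.cast_succ, add_pow, sum_mul, mul_sum]
    refine sum_congr rfl fun j _ => ?_
    rw [one_pow]
    ring
  rw [sum_range_succ, Nat.choose_self, Nat.cast_one, one_mul] at hshift
  have h1z : 1 - z ≠ 0 := (sub_pos.2 hz1).ne'
  field_simp
  linarith

open Finset in
/-- The binomial convolution of `j! / (log 2) ^ j` over `j < m` is at most `m! / (log 2) ^ m`,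
because the exponential series of `log 2` sums to `2`. -/
lemma sum_choose_mul_factorial_div_log_two_pow_le (m : ℕ) :
    ∑ j ∈ range m, (m.choose j : ℝ) * (j.factorial / Real.log 2 ^ j) ≤
      m.factorial / Real.log 2 ^ m := by
  have hL : 0 < Real.log 2 := Real.log_pos one_lt_two
  have hexp : ∑ i ∈ range m, Real.log 2 ^ (i + 1) / (i + 1).factorial ≤ 1 := by
    have h := Real.sum_le_exp_of_nonneg hL.le (m + 1)
    rw [Real.exp_log two_pos, sum_range_succ'] at h
    norm_num at h
    linarith
  calc ∑ j ∈ range m, (m.choose j : ℝ) * (j.factorial / Real.log 2 ^ j)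
      = m.factorial / Real.log 2 ^ m *
          ∑ i ∈ range m, Real.log 2 ^ (i + 1) / (i + 1).factorial := by
        rw [← sum_range_reflect (fun i => Real.log 2 ^ (i + 1) / ((i + 1).factorial : ℝ)), mul_sum]
        refine sum_congr rfl fun j hj => ?_
        have hj : j < m := mem_range.1 hj
        have hsub : m - 1 - j + 1 = m - j := by omega
        rw [hsub, Nat.cast_choose ℝ hj.le, ← pow_sub_mul_pow (Real.log 2) hj.le]
        have := Nat.factorial_ne_zero (m - j)
        have := Nat.factorial_ne_zero j
        field_simp
    _ ≤ m.factorial / Real.log 2 ^ m := mul_le_of_le_one_right (by positivity) hexp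

open Finset in
lemma tsum_pow_mul_geometric_le {z : ℝ} (hz0 : 0 < z) (hz : z ≤ 1 / 2) (m : ℕ) :
    ∑' n : ℕ, (n : ℝ) ^ m * z ^ n ≤ 2 * (m.factorial / Real.log 2 ^ m) := by
  have hL : 0 < Real.log 2 := Real.log_pos one_lt_two
  have hz1 : z < 1 := by linarith
  have h1z : 0 < 1 - z := sub_pos.2 hz1
  induction m using Nat.strong_induction_on with
  | _ m ih =>
    rcases eq_or_ne m 0 with rfl | hm
    · simp only [pow_zero, one_mul, tsum_geometric_of_lt_one hz0.le hz1, Nat.factorial_zero,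
        Nat.cast_one, div_one, mul_one]
      rw [inv_le_comm₀ h1z two_pos]
      linarith
    · rw [tsum_pow_mul_geometric_recurrence hm hz0 hz1]
      calc _ ≤ ∑ j ∈ range m, (m.choose j : ℝ) * ∑' n : ℕ, (n : ℝ) ^ j * z ^ n :=
            mul_le_of_le_one_left
              (sum_nonneg fun j _ => mul_nonneg (by positivity) (tsum_nonneg fun n => by positivity))
              ((div_le_one h1z).2 (by linarith))
        _ ≤ ∑ j ∈ range m, (m.choose j : ℝ) * (2 * (j.factorial / Real.log 2 ^ j)) :=
            sum_le_sum fun j hj => mul_le_mul_of_nonneg_left (ih j (mem_range.1 hj)) (by positivity)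
        _ = 2 * ∑ j ∈ range m, (m.choose j : ℝ) * (j.factorial / Real.log 2 ^ j) := by
            rw [mul_sum]
            exact sum_congr rfl fun j _ => mul_left_comm _ _ _
        _ ≤ _ := by
            gcongr
            exact sum_choose_mul_factorial_div_log_two_pow_le m

lemma factorial_mul_pow_le_tsum_pow_mul_geometric (m : ℕ) {z : ℝ} (hz0 : 0 < z) (hz1 : z < 1) :
    (m.factorial : ℝ) * (z / (1 - z)) ^ (m + 1) ≤ ∑' n : ℕ, (n : ℝ) ^ m * z ^ n := by
  have hnorm : ‖z‖ < 1 := by rwa [Real.norm_of_nonneg hz0.le]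
  have hchoose := hasSum_choose_mul_geometric_of_norm_lt_one m hnorm
  have hshift : HasSum (fun n : ℕ => (m.factorial : ℝ) * z ^ (m + 1) * ((n + m).choose m * z ^ n))
      (m.factorial * (z / (1 - z)) ^ (m + 1)) := by
    rw [div_pow, ← mul_one_div (z ^ (m + 1)), ← mul_assoc]
    exact hchoose.mul_left _
  refine hasSum_le_inj (fun n : ℕ => n + m) (add_left_injective m) (fun n _ => by positivity)
    (fun n => ?_) hshift (summable_pow_mul_geometric_of_norm_lt_one m hnorm).hasSum
  have hle : (m.factorial : ℝ) * (n + m).choose m ≤ ((n + m : ℕ) : ℝ) ^ m := by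
    rw [← Nat.cast_mul, ← Nat.descFactorial_eq_factorial_mul_choose]
    exact_mod_cast Nat.descFactorial_le_pow (n + m) m
  calc (m.factorial : ℝ) * z ^ (m + 1) * ((n + m).choose m * z ^ n)
      = m.factorial * (n + m).choose m * z ^ (n + m + 1) := by ring
    _ ≤ ((n + m : ℕ) : ℝ) ^ m * z ^ (n + m) :=
        mul_le_mul hle (pow_le_pow_of_le_one hz0.le hz1.le (Nat.le_succ _)) (by positivity)
          (by positivity)

/-- Two-sided polylogarithm estimate: for `m ≥ 1` and `0 < z < 1`, the series
`∑_{n≥1} n^m z^n` converges, is bounded below by `m! (z/(1-z))^(m+1)`, and for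
`z ≤ 1/2` it is bounded above by `((m+1)!/(log 2)^(m+2)) (z/(1-z))`. -/
theorem stmt0 (m : ℕ) (hm : 1 ≤ m) (z : ℝ) (hz0 : 0 < z) (hz1 : z < 1) :
    Summable (fun n : ℕ => (n : ℝ) ^ m * z ^ n) ∧
    (Nat.factorial m : ℝ) * (z / (1 - z)) ^ (m + 1) ≤ ∑' n : ℕ, (n : ℝ) ^ m * z ^ n ∧
    (z ≤ 1 / 2 →
      ∑' n : ℕ, (n : ℝ) ^ m * z ^ n ≤
        ((Nat.factorial (m + 1) : ℝ) / (Real.log 2) ^ (m + 2)) * (z / (1 - z))) := by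
  have h1z : 0 < 1 - z := sub_pos.2 hz1
  refine ⟨summable_pow_mul_geometric_of_norm_lt_one m (by rwa [Real.norm_of_nonneg hz0.le]),
    factorial_mul_pow_le_tsum_pow_mul_geometric m hz0 hz1, fun hz => ?_⟩
  have hL : 0 < Real.log 2 := Real.log_pos one_lt_two
  have hL1 : Real.log 2 ≤ 1 := by linarith [Real.log_two_lt_d9]
  have hm' : (1 : ℝ) ≤ m := by exact_mod_cast hm
  rw [tsum_pow_mul_geometric_recurrence (by omega) hz0 hz1, mul_comm]
  gcongr
  calc ∑ j ∈ Finset.range m, (m.choose j : ℝ) * ∑' n : ℕ, (n : ℝ) ^ j * z ^ n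
      ≤ ∑ j ∈ Finset.range m, (m.choose j : ℝ) * (2 * (j.factorial / Real.log 2 ^ j)) := by
        gcongr with j
        exact tsum_pow_mul_geometric_le hz0 hz j
    _ = 2 * ∑ j ∈ Finset.range m, (m.choose j : ℝ) * (j.factorial / Real.log 2 ^ j) := by
        rw [Finset.mul_sum]
        exact Finset.sum_congr rfl fun j _ => mul_left_comm _ _ _
    _ ≤ (m + 1) * (m.factorial / Real.log 2 ^ m) :=
        mul_le_mul (by linarith) (sum_choose_mul_factorial_div_log_two_pow_le m)
          (Finset.sum_nonneg fun j _ => by positivity) (by positivity)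
    _ = (m + 1).factorial / Real.log 2 ^ m := by
        rw [Nat.factorial_succ]
        push_cast
        ring
    _ ≤ (m + 1).factorial / Real.log 2 ^ (m + 2) :=
        div_le_div_of_nonneg_left (by positivity) (by positivity)
          (pow_le_pow_of_le_one hL.le hL1 (by omega))
end

section
/- Let q ≥ 2 be a real number, C > 0, and let N : ℕ × ℕ → ℝ satisfy 0 ≤ N(n,g) ≤ (C^g/(6g)!) · n^{6g−4} for all integers n ≥ 1 and g ≥ 1. Then for every real β > 0 such that q^{−β} ≤ 1/2 and C · q^{−β} ≤ (log 2)^6, the double series ∑_{g≥1} ∑_{n≥1} N(n,g) · q^{−β(n+g)} converges. -/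
theorem tsum_pow_div_factorial_comp_le_exp {y : ℝ} (hy : 0 ≤ y) {f : ℕ → ℕ}
    (hf : Function.Injective f) :
    ∑' k, y ^ f k / ((f k).factorial : ℝ) ≤ Real.exp y := by
  rw [Real.exp_eq_exp_ℝ, NormedSpace.exp_eq_tsum_div]
  exact tsum_comp_le_tsum_of_inj (Real.summable_pow_div_factorial y)
    (fun n => by positivity) hf

/-- The weights `(n log 2)^{f(k)} / f(k)! · n⁻⁴ 2⁻ⁿ` are jointly summable over `n ≥ 1` and `k`, for
any injective `f`: summing over `k` first leaves at most `n⁻⁴`. -/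
theorem summable_log_two_mul_pow_div_factorial {f : ℕ → ℕ} (hf : Function.Injective f) :
    Summable (fun p : ℕ × ℕ =>
      (Real.log 2 * ((p.1 + 1 : ℕ) : ℝ)) ^ f p.2 / ((f p.2).factorial : ℝ) *
        (1 / ((p.1 + 1 : ℕ) : ℝ) ^ 4 * (1 / 2) ^ (p.1 + 1))) := by
  have hL : 0 ≤ Real.log 2 := Real.log_nonneg (by norm_num)
  have hzeta : Summable (fun n : ℕ => 1 / ((n + 1 : ℕ) : ℝ) ^ 4) :=
    (summable_nat_add_iff (f := fun n : ℕ => 1 / (n : ℝ) ^ 4) 1).2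
      (Real.summable_one_div_nat_pow.2 (by norm_num))
  have hrow (y : ℝ) : Summable (fun k => y ^ f k / ((f k).factorial : ℝ)) :=
    (Real.summable_pow_div_factorial y).comp_injective hf
  refine (summable_prod_of_nonneg ?_).2 ⟨?_, ?_⟩
  · intro p
    simp only [Pi.zero_apply]
    positivity
  · intro n
    simp only
    exact (hrow (Real.log 2 * ((n + 1 : ℕ) : ℝ))).mul_right
      (1 / ((n + 1 : ℕ) : ℝ) ^ 4 * (1 / 2) ^ (n + 1))
  simp only
  refine Summable.of_nonneg_of_le (fun n => tsum_nonneg fun k => by positivity) (fun n => ?_) hzeta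
  rw [tsum_mul_right]
  have hexp : Real.exp (Real.log 2 * ((n + 1 : ℕ) : ℝ)) = 2 ^ (n + 1) := by
    rw [mul_comm, Real.exp_nat_mul, Real.exp_log (by norm_num)]
  calc _ ≤ Real.exp (Real.log 2 * ((n + 1 : ℕ) : ℝ)) *
        (1 / ((n + 1 : ℕ) : ℝ) ^ 4 * (1 / 2) ^ (n + 1)) := by
        refine mul_le_mul_of_nonneg_right ?_ (by positivity)
        exact tsum_pow_div_factorial_comp_le_exp (by positivity) hf
    _ = 1 / ((n + 1 : ℕ) : ℝ) ^ 4 := by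
        rw [hexp, mul_left_comm, ← mul_pow]
        norm_num

/-- Convergence half of Theorem 2.3: if `0 ≤ N(n,g) ≤ (C^g/(6g)!) n^{6g-4}` for
`n, g ≥ 1`, then for `β > 0` with `q^{-β} ≤ 1/2` and `C q^{-β} ≤ (log 2)^6`, the
double series `∑_{g≥1} ∑_{n≥1} N(n,g) q^{-β(n+g)}` converges. -/
theorem stmt1 (q C : ℝ) (hq : 2 ≤ q) (hC : 0 < C) (N : ℕ × ℕ → ℝ)
    (hN : ∀ n g : ℕ, 1 ≤ n → 1 ≤ g →
      0 ≤ N (n, g) ∧ N (n, g) ≤ C ^ g / (Nat.factorial (6 * g) : ℝ) * (n : ℝ) ^ (6 * g - 4))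
    (β : ℝ) (hβ : 0 < β) (h1 : q ^ (-β) ≤ 1 / 2)
    (h2 : C * q ^ (-β) ≤ (Real.log 2) ^ 6) :
    Summable (fun p : ℕ × ℕ =>
      N (p.1 + 1, p.2 + 1) * q ^ (-(β * (((p.1 + 1 : ℕ) : ℝ) + ((p.2 + 1 : ℕ) : ℝ))))) := by
  have hq0 : 0 < q := by linarith
  have hx : 0 < q ^ (-β) := Real.rpow_pos_of_pos hq0 _
  have hsplit : ∀ m k : ℕ, q ^ (-(β * ((m : ℝ) + (k : ℝ)))) =
      (q ^ (-β)) ^ m * (q ^ (-β)) ^ k := fun m k => by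
    rw [← pow_add, ← Real.rpow_natCast, ← Real.rpow_mul hq0.le]
    push_cast
    ring_nf
  simp only [hsplit]
  have hinj : Function.Injective (fun g : ℕ => 6 * (g + 1)) := fun a b h => by
    simp only at h
    omega
  generalize q ^ (-β) = x at hx h1 h2
  refine Summable.of_nonneg_of_le (fun p => ?_) (fun p => ?_)
    (summable_log_two_mul_pow_div_factorial hinj)
  · exact mul_nonneg (hN _ _ (by omega) (by omega)).1 (by positivity)
  · obtain ⟨n, g⟩ := p
    have hb := (hN (n + 1) (g + 1) (by omega) (by omega)).2
    have he : 6 * (g + 1) - 4 = 6 * g + 2 := by omega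
    rw [he] at hb
    have hn : ((n + 1 : ℕ) : ℝ) ≠ 0 := by positivity
    simp only
    generalize ((n + 1 : ℕ) : ℝ) = y at hb hn
    have hy : 0 ≤ y ^ (6 * g + 2) := Even.pow_nonneg ⟨3 * g + 1, by ring⟩ y
    calc _ ≤ C ^ (g + 1) / ((6 * (g + 1)).factorial : ℝ) * y ^ (6 * g + 2) *
          (x ^ (n + 1) * x ^ (g + 1)) := mul_le_mul_of_nonneg_right hb (by positivity)
      _ = (C * x) ^ (g + 1) * x ^ (n + 1) *
          (y ^ (6 * g + 2) / ((6 * (g + 1)).factorial : ℝ)) := by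
          rw [mul_pow]
          ring
      _ ≤ (Real.log 2 ^ 6) ^ (g + 1) * (1 / 2) ^ (n + 1) *
          (y ^ (6 * g + 2) / ((6 * (g + 1)).factorial : ℝ)) := by
          gcongr
      _ = _ := by
          have hpow : y ^ (6 * (g + 1)) = y ^ (6 * g + 2) * y ^ 4 := by
            rw [← pow_add, mul_add]
          rw [mul_pow, hpow, ← pow_mul]
          field_simp
end

section
/- Let q ≥ 2 be a real number, C > 0, and let N : ℕ × ℕ → ℝ satisfy N(n,g) ≥ (C^g/(6g)!) · n^{6g−4} for all integers n ≥ 1 and g ≥ 1. Set λ_β := q^{−β}/(1−q^{−β}) for β > 0. If C · λ_β^6 · q^{−β} > 1, then the double series ∑_{g≥1} ∑_{n≥1} N(n,g) · q^{−β(n+g)} diverges (its partial sums are unbounded). -/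
/-- The negative binomial series, scaled by `k! x ^ k`. -/
theorem hasSum_factorial_mul_choose_mul_pow (k : ℕ) {x : ℝ} (hx0 : 0 ≤ x) (hx1 : x < 1) :
    HasSum (fun n : ℕ => (k.factorial : ℝ) * ((n + k).choose k : ℝ) * x ^ (n + k))
      (k.factorial * (x ^ k / (1 - x) ^ (k + 1))) := by
  have h := (hasSum_choose_mul_geometric_of_norm_lt_one k
    (by rwa [Real.norm_of_nonneg hx0] : ‖x‖ < 1)).mul_left (k.factorial * x ^ k : ℝ)
  have hf : (fun n : ℕ => (k.factorial : ℝ) * ((n + k).choose k : ℝ) * x ^ (n + k)) =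
      fun n => k.factorial * x ^ k * ((n + k).choose k * x ^ n) := by
    funext n
    rw [pow_add]
    ring
  have hv : (k.factorial : ℝ) * (x ^ k / (1 - x) ^ (k + 1)) =
      k.factorial * x ^ k * (1 / (1 - x) ^ (k + 1)) := by ring
  rwa [hf, hv]

theorem factorial_mul_choose_le_pow (n k : ℕ) :
    (k.factorial : ℝ) * (n.choose k : ℝ) ≤ (n : ℝ) ^ k := by
  have h := Nat.descFactorial_le_pow n k
  rw [Nat.descFactorial_eq_factorial_mul_choose] at h
  exact_mod_cast h

theorem factorial_add_four_le (k : ℕ) :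
    ((k + 4).factorial : ℝ) ≤ k.factorial * ((k + 4 : ℕ) : ℝ) ^ 4 := by
  have h : (k + 4).factorial ≤ k.factorial * (k + 4) ^ 4 := by
    calc (k + 4).factorial = k.factorial * ((k + 1) * (k + 2) * (k + 3) * (k + 4)) := by
          simp only [Nat.factorial_succ]
          ring
      _ ≤ k.factorial * ((k + 4) * (k + 4) * (k + 4) * (k + 4)) := by gcongr <;> omega
      _ = _ := by ring
  exact_mod_cast h

/-- Divergence half of Theorem 2.3: if `N(n,g) ≥ (C^g/(6g)!) n^{6g-4}` for
`n, g ≥ 1` and, with `λ_β = q^{-β}/(1-q^{-β})`, one has `C λ_β^6 q^{-β} > 1`,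
then the double series `∑_{g≥1} ∑_{n≥1} N(n,g) q^{-β(n+g)}` diverges. -/
theorem stmt2 (q C : ℝ) (hq : 2 ≤ q) (hC : 0 < C) (N : ℕ × ℕ → ℝ)
    (hN : ∀ n g : ℕ, 1 ≤ n → 1 ≤ g →
      C ^ g / (Nat.factorial (6 * g) : ℝ) * (n : ℝ) ^ (6 * g - 4) ≤ N (n, g))
    (β : ℝ) (hβ : 0 < β)
    (hdiv : C * (q ^ (-β) / (1 - q ^ (-β))) ^ 6 * q ^ (-β) > 1) :
    ¬ Summable (fun p : ℕ × ℕ =>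
      N (p.1 + 1, p.2 + 1) * q ^ (-(β * (((p.1 + 1 : ℕ) : ℝ) + ((p.2 + 1 : ℕ) : ℝ))))) := by
  intro hs
  have hq0 : 0 < q := by linarith
  have hpow : ∀ a b : ℕ, q ^ (-(β * ((a : ℝ) + (b : ℝ)))) = (q ^ (-β)) ^ a * (q ^ (-β)) ^ b := by
    intro a b
    rw [← pow_add, ← Real.rpow_natCast, ← Real.rpow_mul hq0.le]
    push_cast
    ring_nf
  simp only [hpow] at hs
  have hx0 : 0 < q ^ (-β) := Real.rpow_pos_of_pos hq0 _
  have hx1 : q ^ (-β) < 1 := Real.rpow_lt_one_of_one_lt_of_neg (by linarith) (by linarith)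
  generalize q ^ (-β) = x at *
  have hy : 0 < 1 - x := by linarith
  set l := x / (1 - x) with hl
  have hl0 : 0 < l := by positivity
  set F : ℕ × ℕ → ℝ := fun p => N (p.2 + 1, p.1 + 1) * (x ^ (p.2 + 1) * x ^ (p.1 + 1)) with hF
  have hFs : Summable F := hs.prod_symm
  have hF0 : ∀ p, 0 ≤ F p := fun p =>
    mul_nonneg (le_trans (by positivity) (hN (p.2 + 1) (p.1 + 1) (by omega) (by omega)))
      (by positivity)
  have hlim := hFs.prod.tendsto_atTop_zero
  have hbound : ∀ g : ℕ, (C * l ^ 6 * x) ^ (g + 1) / (l ^ 4 * (6 * ((g + 1 : ℕ) : ℝ)) ^ 4) ≤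
      ∑' n, F (g, n) := by
    intro g
    obtain ⟨k, hk⟩ : ∃ k, k = 6 * g + 2 := ⟨_, rfl⟩
    have hk4 : 6 * (g + 1) = k + 4 := by omega
    have hfs : Summable fun n => F (g, n) := hFs.prod_factor g
    have hinj : Function.Injective fun n : ℕ => n + (6 * g + 1) := add_left_injective _
    have hsum := (hasSum_factorial_mul_choose_mul_pow k hx0.le hx1).mul_left
      (C ^ (g + 1) / ((k + 4).factorial : ℝ) * x ^ (g + 1))
    have hle : C ^ (g + 1) / ((k + 4).factorial : ℝ) * x ^ (g + 1) *
        (k.factorial * (x ^ k / (1 - x) ^ (k + 1))) ≤ ∑' n, F (g, n) := by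
      refine le_trans ?_ (tsum_comp_le_tsum_of_inj hfs (fun n => hF0 _) hinj)
      refine hasSum_le (fun n => ?_) hsum (hfs.comp_injective hinj).hasSum
      have h1 := hN (n + k) (g + 1) (by omega) (by omega)
      rw [hk4, Nat.add_sub_cancel] at h1
      have h2 := factorial_mul_choose_le_pow (n + k) k
      have h3 : n + (6 * g + 1) + 1 = n + k := by omega
      simp only [hF, Function.comp_apply, h3]
      calc _ = C ^ (g + 1) / ((k + 4).factorial : ℝ) *
            ((k.factorial : ℝ) * ((n + k).choose k : ℝ)) * (x ^ (n + k) * x ^ (g + 1)) := by ring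
        _ ≤ C ^ (g + 1) / ((k + 4).factorial : ℝ) * ((n + k : ℕ) : ℝ) ^ k *
            (x ^ (n + k) * x ^ (g + 1)) := by gcongr
        _ ≤ _ := by gcongr
    refine le_trans ?_ hle
    have hfac := factorial_add_four_le k
    have hkc : (6 * ((g + 1 : ℕ) : ℝ)) = ((k + 4 : ℕ) : ℝ) := by exact_mod_cast hk4
    have hlk : l ^ k ≤ x ^ k / (1 - x) ^ (k + 1) := by
      rw [hl, div_pow]
      exact div_le_div_of_nonneg_left (by positivity) (by positivity)
        (pow_le_pow_of_le_one hy.le (by linarith) k.le_succ)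
    have hl6 : (C * l ^ 6 * x) ^ (g + 1) = C ^ (g + 1) * x ^ (g + 1) * (l ^ k * l ^ 4) := by
      rw [← pow_add, ← hk4, mul_pow, mul_pow, ← pow_mul]
      ring
    rw [hkc, hl6]
    have hfac' : 1 / ((k + 4 : ℕ) : ℝ) ^ 4 ≤ k.factorial / ((k + 4).factorial : ℝ) := by
      rw [div_le_div_iff₀ (by positivity) (by positivity)]
      linarith
    calc _ = C ^ (g + 1) * x ^ (g + 1) * (1 / ((k + 4 : ℕ) : ℝ) ^ 4) * l ^ k := by
          field_simp
      _ ≤ C ^ (g + 1) * x ^ (g + 1) * (k.factorial / ((k + 4).factorial : ℝ)) *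
          (x ^ k / (1 - x) ^ (k + 1)) := by gcongr
      _ = _ := by ring
  have hzero := (tendsto_pow_const_div_const_pow_of_one_lt 4 hdiv).comp
    (Filter.tendsto_add_atTop_nat 1)
  have hprod := (hlim.mul hzero).mul_const (l ^ 4 * 6 ^ 4)
  have hr : 0 < C * l ^ 6 * x := by positivity
  have hone := ge_of_tendsto' hprod (b := 1) fun g => by
    have hb := hbound g
    rw [div_le_iff₀ (by positivity)] at hb
    simp only [Function.comp_apply]
    rw [← mul_div_assoc, div_mul_eq_mul_div, le_div_iff₀ (by positivity)]
    linarith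
  norm_num at hone
end

section
/- For real q ≥ 2, let β_−(q) denote the unique β > log 2/log q satisfying β − 6 log λ_β = 2 log 20 − 6 log log 2, where λ_β := q^{−β}/(1−q^{−β}). Then: (i) β_−(q) is strictly decreasing as a function of q on [2,∞); (ii) β_−(2) < 1.94; and (iii) for every q ≥ 2, β_−(q) < β_+ := log(2^{20}/3^6) − 6 log log 2. -/
lemma log_rpow_neg_div {q b : ℝ} (hq : 0 < q) :
    Real.log (q ^ (-b) / (1 - q ^ (-b))) = -Real.log (q ^ b - 1) := by
  have h : q ^ (-b) / (1 - q ^ (-b)) = (q ^ b - 1)⁻¹ := by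
    have hpos : 0 < q ^ b := Real.rpow_pos_of_pos hq b
    rw [Real.rpow_neg hq.le]
    field_simp
  rw [h, Real.log_inv]

lemma two_lt_rpow_of_log_div_log_lt {q b : ℝ} (hq : 1 < q)
    (h : Real.log 2 / Real.log q < b) : 2 < q ^ b := by
  rw [div_lt_iff₀ (Real.log_pos hq)] at h
  rw [Real.lt_rpow_iff_log_lt two_pos (by linarith)]
  exact h

lemma two_rpow_lower_bound : (3.837 : ℝ) < 2 ^ (1.94 : ℝ) := by
  have h : ((2 : ℝ) ^ (1.94 : ℝ)) ^ 50 = 2 ^ 97 := by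
    rw [← Real.rpow_natCast, ← Real.rpow_mul zero_le_two, ← Real.rpow_natCast]
    norm_num
  refine lt_of_pow_lt_pow_left₀ 50 (by positivity) ?_
  rw [h]
  norm_num

lemma log_upper_bound : Real.log 6.93 < 1.94 := by
  rw [Real.log_lt_iff_lt_exp (by norm_num)]
  have h : Real.exp 1.94 ^ 50 = Real.exp 1 ^ 97 := by
    rw [← Real.exp_nat_mul, ← Real.exp_nat_mul]
    norm_num
  refine lt_of_pow_lt_pow_left₀ 50 (by positivity) ?_
  rw [h]
  calc (6.93 : ℝ) ^ 50 < 2.718 ^ 97 := by norm_num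
    _ < Real.exp 1 ^ 97 :=
      pow_lt_pow_left₀ (by linarith [Real.exp_one_gt_d9]) (by norm_num) (by norm_num)

/-- At `q = 2` and `β = 1.94` the defining function exceeds its target value. -/
lemma target_lt_value_at_two :
    2 * Real.log 20 - 6 * Real.log (Real.log 2) <
      1.94 + 6 * Real.log ((2 : ℝ) ^ (1.94 : ℝ) - 1) := by
  have h1 : Real.log 2.837 ≤ Real.log ((2 : ℝ) ^ (1.94 : ℝ) - 1) :=
    Real.log_le_log (by norm_num) (by linarith [two_rpow_lower_bound])
  have h2 : Real.log 0.6931 ≤ Real.log (Real.log 2) :=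
    Real.log_le_log (by norm_num) (by linarith [Real.log_two_gt_d9])
  have h3 : 2 * Real.log 20 <
      Real.log 6.93 + 6 * (Real.log 2.837 + Real.log 0.6931) := by
    have e1 : 2 * Real.log 20 = Real.log (20 ^ 2) := by
      rw [Real.log_pow]; norm_num
    have e2 : Real.log 6.93 + 6 * (Real.log 2.837 + Real.log 0.6931) =
        Real.log (6.93 * (2.837 * 0.6931) ^ 6) := by
      rw [Real.log_mul (by norm_num) (by norm_num), Real.log_pow,
        Real.log_mul (by norm_num) (by norm_num)]
      norm_num
    rw [e1, e2]
    exact Real.log_lt_log (by norm_num) (by norm_num)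
  linarith [log_upper_bound]

lemma lt_log_sub_log_log_two :
    1.94 < Real.log (2 ^ 20 / 3 ^ 6) - 6 * Real.log (Real.log 2) := by
  have h1 : Real.log (Real.log 2) < 0 :=
    Real.log_neg (Real.log_pos one_lt_two) (by linarith [Real.log_two_lt_d9])
  have h2 : Real.log (2 ^ 10) ≤ Real.log (2 ^ 20 / 3 ^ 6) :=
    Real.log_le_log (by norm_num) (by norm_num)
  rw [Real.log_pow] at h2
  push_cast at h2
  linarith [Real.log_two_gt_d9]

/-- Quantitative facts about the threshold `β₋(q)`, the unique
`β > log 2/log q` with `β - 6 log λ_β = 2 log 20 - 6 log log 2`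
(where `λ_β = q^{-β}/(1-q^{-β})`): it is strictly decreasing in `q` on `[2,∞)`,
`β₋(2) < 1.94`, and `β₋(q) < β₊ = log(2^20/3^6) - 6 log log 2` for all `q ≥ 2`. -/
theorem stmt4 (βm : ℝ → ℝ)
    (hβm : ∀ q : ℝ, 2 ≤ q →
      Real.log 2 / Real.log q < βm q ∧
      βm q - 6 * Real.log (q ^ (-(βm q)) / (1 - q ^ (-(βm q)))) =
        2 * Real.log 20 - 6 * Real.log (Real.log 2)) :
    StrictAntiOn βm (Set.Ici (2 : ℝ)) ∧
    βm 2 < 1.94 ∧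
    ∀ q : ℝ, 2 ≤ q →
      βm q < Real.log (2 ^ 20 / 3 ^ 6) - 6 * Real.log (Real.log 2) := by
  have two_lt : ∀ q : ℝ, 2 ≤ q → 2 < q ^ βm q := fun q hq =>
    two_lt_rpow_of_log_div_log_lt (by linarith) (hβm q hq).1
  have pos : ∀ q : ℝ, 2 ≤ q → 0 < βm q := fun q hq =>
    (div_pos (Real.log_pos one_lt_two) (Real.log_pos (by linarith))).trans (hβm q hq).1
  have value : ∀ q : ℝ, 2 ≤ q →
      βm q + 6 * Real.log (q ^ βm q - 1) =
        2 * Real.log 20 - 6 * Real.log (Real.log 2) := by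
    intro q hq
    have h := (hβm q hq).2
    rw [log_rpow_neg_div (by linarith)] at h
    linarith
  have anti : StrictAntiOn βm (Set.Ici (2 : ℝ)) := by
    intro q hq r hr hqr
    rw [Set.mem_Ici] at hq hr
    by_contra! hle
    have hpow : q ^ βm q < r ^ βm r :=
      (Real.rpow_lt_rpow (by linarith) hqr (pos q hq)).trans_le
        (Real.rpow_le_rpow_of_exponent_le (by linarith) hle)
    have hlog : Real.log (q ^ βm q - 1) < Real.log (r ^ βm r - 1) :=
      Real.log_lt_log (by linarith [two_lt q hq]) (by linarith)
    linarith [value q hq, value r hr]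
  have at_two : βm 2 < 1.94 := by
    by_contra! hle
    have hlog : Real.log ((2 : ℝ) ^ (1.94 : ℝ) - 1) ≤ Real.log (2 ^ βm 2 - 1) :=
      Real.log_le_log (by linarith [two_rpow_lower_bound])
        (by linarith [Real.rpow_le_rpow_of_exponent_le (x := (2 : ℝ)) one_le_two hle])
    linarith [value 2 le_rfl, target_lt_value_at_two]
  exact ⟨anti, at_two, fun q hq =>
    ((anti.antitoneOn Set.self_mem_Ici hq hq).trans_lt at_two).trans lt_log_sub_log_log_two⟩
end

section
/- For every real q ≥ 2, setting β = π/log q and λ_β := q^{−β}/(1−q^{−β}), one has the strict inequality β − 6 log λ_β + 6 log β > log 400 − 6 log log q. -/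
/-- Positivity of `H(q)`: for real `q ≥ 2` and `β = π/log q`,
`β - 6 log λ_β + 6 log β > log 400 - 6 log log q`,
where `λ_β = q^{-β}/(1-q^{-β})`. -/
theorem stmt6 (q : ℝ) (hq : 2 ≤ q) :
    Real.pi / Real.log q -
        6 * Real.log (q ^ (-(Real.pi / Real.log q)) /
          (1 - q ^ (-(Real.pi / Real.log q)))) +
        6 * Real.log (Real.pi / Real.log q) >
      Real.log 400 - 6 * Real.log (Real.log q) := by
  have hL : 0 < Real.log q := Real.log_pos (by linarith)
  have hpi := Real.pi_gt_three
  have hexp : Real.pi + 1 < Real.exp Real.pi := Real.add_one_lt_exp Real.pi_ne_zero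
  have hpow : q ^ (-(Real.pi / Real.log q)) = (Real.exp Real.pi)⁻¹ := by
    rw [Real.rpow_def_of_pos (by linarith), ← Real.exp_neg]
    congr 1
    field_simp
  have hlam : (Real.exp Real.pi)⁻¹ / (1 - (Real.exp Real.pi)⁻¹) = (Real.exp Real.pi - 1)⁻¹ := by
    have h : Real.exp Real.pi - 1 ≠ 0 := by linarith
    field_simp
  rw [hpow, hlam, Real.log_inv, Real.log_div Real.pi_ne_zero hL.ne']
  have h400 : Real.log 400 < 6 * Real.log 3 := by
    rw [show 6 * Real.log 3 = Real.log (3 ^ 6) by rw [Real.log_pow]; norm_num]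
    exact Real.log_lt_log (by norm_num) (by norm_num)
  have hlog : Real.log 3 ≤ Real.log (Real.exp Real.pi - 1) :=
    Real.log_le_log (by norm_num) (by linarith)
  have hlogpi : 0 < Real.log Real.pi := Real.log_pos (by linarith)
  have hbeta : 0 < Real.pi / Real.log q := by positivity
  linarith
end

section
/- Let ι be a type and x : ι → ℝ a function with 0 ≤ x(a) < 1 for every a and with ∑_a x(a) < ∞ (the family x is summable). Then: (i) the family a ↦ (1 − x(a))^{−1} is multipliable; (ii) the function on finite multisets over ι sending a multiset m to the product ∏_{a ∈ m} x(a) (taken with multiplicity) is summable; and (iii) ∑_{m ∈ Multiset ι} ∏_{a ∈ m} x(a) = ∏_{a ∈ ι} (1 − x(a))^{−1}. -/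
/-- The multisets supported in a finite set `s` contribute the finite Euler product over `s`. -/
theorem hasSum_multiset_prod_of_supported {ι : Type*} (x : ι → ℝ) (h0 : ∀ a, 0 ≤ x a)
    (h1 : ∀ a, x a < 1) (s : Finset ι) :
    HasSum (fun m : {m : Multiset ι // ∀ b ∈ m, b ∈ s} => (m.1.map x).prod)
      (∏ a ∈ s, (1 - x a)⁻¹) := by
  classical
  induction s using Finset.induction_on with
  | empty =>
    let _ : Unique {m : Multiset ι // ∀ b ∈ m, b ∈ (∅ : Finset ι)} :=
      { default := ⟨0, by simp⟩
        uniq := fun m => Subtype.ext (Multiset.eq_zero_of_forall_notMem fun b hb => by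
          simpa using m.2 b hb) }
    have hd : (default : {m : Multiset ι // ∀ b ∈ m, b ∈ (∅ : Finset ι)}).1 = 0 := rfl
    simpa [hd] using hasSum_unique
      (fun m : {m : Multiset ι // ∀ b ∈ m, b ∈ (∅ : Finset ι)} => (m.1.map x).prod)
  | insert a s ha ih =>
    let e : ℕ × {m : Multiset ι // ∀ b ∈ m, b ∈ s} ≃
        {m : Multiset ι // ∀ b ∈ m, b ∈ insert a s} :=
      { toFun := fun p => ⟨Multiset.replicate p.1 a + p.2.1, fun b hb => by
          rcases Multiset.mem_add.1 hb with h | h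
          · simp [Multiset.eq_of_mem_replicate h]
          · exact Finset.mem_insert_of_mem (p.2.2 b h)⟩
        invFun := fun m => (m.1.count a, ⟨m.1.filter (fun b => ¬ a = b), fun b hb => by
          have h := Multiset.mem_filter.1 hb
          exact (Finset.mem_insert.1 (m.2 b h.1)).resolve_left (Ne.symm h.2)⟩)
        left_inv := fun ⟨n, m, hm⟩ => by
          have ham : a ∉ m := fun h => ha (hm a h)
          ext b
          · simp [Multiset.count_eq_zero_of_notMem ham]
          · by_cases hab : a = b
            · subst hab
              simp [Multiset.count_eq_zero_of_notMem ham]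
            · simp [Multiset.count_replicate, hab]
        right_inv := fun ⟨m, hm⟩ => by
          ext b
          by_cases hab : a = b
          · subst hab
            simp
          · simp [Multiset.count_replicate, hab] }
    rw [Finset.prod_insert ha, ← e.hasSum_iff]
    have hg := hasSum_geometric_of_lt_one (h0 a) (h1 a)
    have hp := hg.mul ih (hg.summable.mul_of_nonneg ih.summable (fun n => pow_nonneg (h0 a) n)
      fun m => Multiset.prod_map_nonneg fun b _ => h0 b)
    exact hp.congr_fun fun p => by simp [e]


/-- Euler product expansion (Lemma 2.5), abstractly: if `0 ≤ x a < 1` for all `a`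
and `x` is summable, then `a ↦ (1 - x a)⁻¹` is multipliable, the function on
finite multisets `m ↦ ∏_{a ∈ m} x a` (with multiplicity) is summable, and
`∑_m ∏_{a ∈ m} x a = ∏_a (1 - x a)⁻¹`. -/
theorem stmt7 {ι : Type*} (x : ι → ℝ) (h0 : ∀ a, 0 ≤ x a) (h1 : ∀ a, x a < 1)
    (hs : Summable x) :
    Multipliable (fun a : ι => (1 - x a)⁻¹) ∧
    Summable (fun m : Multiset ι => (m.map x).prod) ∧
    ∑' m : Multiset ι, (m.map x).prod = ∏' a : ι, (1 - x a)⁻¹ := by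
  classical
  have hpos : ∀ a, 0 < 1 - x a := fun a => sub_pos.2 (h1 a)
  have hM : Multipliable (fun a : ι => (1 - x a)⁻¹) := by
    refine Real.multipliable_of_summable_log (fun a => inv_pos.2 (hpos a)) ?_
    simpa [Real.log_inv, sub_eq_add_neg] using
      (Real.summable_log_one_add_of_summable hs.neg).neg
  have hone : ∀ a, 1 ≤ (1 - x a)⁻¹ := fun a =>
    (one_le_inv₀ (hpos a)).2 (by linarith [h0 a])
  have hf : ∀ m : Multiset ι, 0 ≤ (m.map x).prod := fun m =>
    Multiset.prod_map_nonneg fun b _ => h0 b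
  have hle : ∀ s : Finset ι, ∏ a ∈ s, (1 - x a)⁻¹ ≤ ∏' a, (1 - x a)⁻¹ := fun s =>
    Monotone.ge_of_tendsto (fun t u htu => Finset.prod_le_prod_of_subset_of_one_le htu
      (fun a _ => inv_nonneg.2 (hpos a).le) fun a _ _ => hone a) hM.hasProd s
  have hS : HasSum (fun m : Multiset ι => (m.map x).prod) (∏' a, (1 - x a)⁻¹) := by
    refine hasSum_of_isLUB_of_nonneg _ hf ⟨?_, fun c hc => ?_⟩
    · rintro _ ⟨T, rfl⟩
      refine le_trans ?_ (hle (T.biUnion Multiset.toFinset))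
      have h := hasSum_multiset_prod_of_supported x h0 h1 (T.biUnion Multiset.toFinset)
      have hT := Finset.sum_subtype_of_mem (fun m : Multiset ι => (m.map x).prod)
        (p := fun m => ∀ b ∈ m, b ∈ T.biUnion Multiset.toFinset)
        fun m hm b hb => Finset.mem_biUnion.2 ⟨m, hm, Multiset.mem_toFinset.2 hb⟩
      refine hT.symm.trans_le ?_
      exact sum_le_hasSum _ (fun m _ => hf m) h
    · refine le_of_tendsto' hM.hasProd fun s => ?_
      refine hasSum_le_of_sum_le (hasSum_multiset_prod_of_supported x h0 h1 s) fun T => ?_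
      simpa using hc ⟨T.map (Function.Embedding.subtype _), rfl⟩
  exact ⟨hM, hS.summable, hS.tsum_eq⟩
end

section
/- Let ι be a type and x : ι → ℝ a function with 0 ≤ x(a) < 1 for every a and with ∑_a x(a) < ∞. Then the function sending a finitely supported function d : ι → ℤ to the product ∏_{a} x(a)^{|d(a)|} is summable, the family a ↦ (1 − x(a)²)/(1 − x(a))² is multipliable, and ∑_{d : ι →₀ ℤ} ∏_a x(a)^{|d(a)|} = ∏_{a ∈ ι} (1 − x(a)²)/(1 − x(a))². -/
/-- Splitting off the value at `a` of a function supported in `insert a s`. -/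
noncomputable def Finsupp.supportInsertEquiv {ι M : Type*} [DecidableEq ι] [Zero M]
    {a : ι} {s : Finset ι} (ha : a ∉ s) :
    {d : ι →₀ M // d.support ⊆ insert a s} ≃ M × {d : ι →₀ M // d.support ⊆ s} where
  toFun d := (d.1 a, ⟨d.1.erase a, by
    rw [Finsupp.support_erase, ← Finset.subset_insert_iff]
    exact d.2⟩)
  invFun p := ⟨p.2.1.update a p.1, (Finsupp.support_update_subset _ _).trans
    (Finset.insert_subset_insert a p.2.2)⟩
  left_inv d := by
    ext b
    by_cases hb : b = a <;> simp [hb]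
  right_inv p := by
    obtain ⟨n, d, hd⟩ := p
    have hda : d a = 0 := Finsupp.notMem_support_iff.mp fun h => ha (hd h)
    simp only [Prod.mk.injEq, Subtype.mk.injEq]
    refine ⟨by simp, ?_⟩
    ext b
    by_cases hb : b = a <;> simp [hb, hda]

theorem hasSum_finsupp_prod_of_support_subset {ι M : Type*} [Zero M] {f : ι → M → ℝ}
    {F : ι → ℝ} (hf : ∀ a n, 0 ≤ f a n) (hf0 : ∀ a, f a 0 = 1) (hF : ∀ a, HasSum (f a) (F a))
    (s : Finset ι) :
    HasSum (fun d : {d : ι →₀ M // d.support ⊆ s} => d.1.prod f) (∏ a ∈ s, F a) := by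
  classical
  induction s using Finset.induction_on with
  | empty =>
    have : Unique {d : ι →₀ M // d.support ⊆ ∅} :=
      ⟨⟨⟨0, by simp⟩⟩, fun d => Subtype.ext (by simpa using d.2)⟩
    convert hasSum_unique (fun d : {d : ι →₀ M // d.support ⊆ ∅} => d.1.prod f) using 1
    have h : (default : {d : ι →₀ M // d.support ⊆ ∅}).1 = 0 := by
      simpa using (default : {d : ι →₀ M // d.support ⊆ ∅}).2
    simp [h]
  | insert a s ha ih =>
    rw [Finset.prod_insert ha]
    have hmul := (hF a).mul ih ((hF a).summable.mul_of_nonneg ih.summable (hf a)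
      fun d => Finset.prod_nonneg fun b _ => hf b _)
    have h := (Finsupp.supportInsertEquiv ha).hasSum_iff.mpr hmul
    exact (funext fun d : {d : ι →₀ M // d.support ⊆ insert a s} =>
      Finsupp.mul_prod_erase' d.1 a f hf0) ▸ h

/-- Euler product expansion for nonnegative real series indexed by finitely supported functions. -/
theorem hasSum_finsupp_prod_of_hasProd {ι M : Type*} [Zero M] {f : ι → M → ℝ}
    {F : ι → ℝ} {P : ℝ} (hf : ∀ a n, 0 ≤ f a n) (hf0 : ∀ a, f a 0 = 1)
    (hF : ∀ a, HasSum (f a) (F a)) (hP : HasProd F P) :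
    HasSum (fun d : ι →₀ M => d.prod f) P := by
  classical
  have hnonneg (d : ι →₀ M) : 0 ≤ d.prod f := Finset.prod_nonneg fun b _ => hf b _
  have hF1 (a : ι) : 1 ≤ F a := hf0 a ▸ le_hasSum (hF a) 0 fun n _ => hf a n
  have hmono : Monotone fun s : Finset ι => ∏ a ∈ s, F a := fun s t hst =>
    Finset.prod_le_prod_of_subset_of_one_le hst (fun a _ => zero_le_one.trans (hF1 a))
      fun a _ _ => hF1 a
  refine hasSum_of_isLUB_of_nonneg P hnonneg ⟨?_, fun b hb => ?_⟩
  · rintro _ ⟨T, rfl⟩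
    have hT : ∀ d ∈ T, d.support ⊆ T.sup Finsupp.support := fun d hd => Finset.le_sup hd
    have h := sum_le_hasSum (T.subtype fun d => d.support ⊆ T.sup Finsupp.support)
      (fun d _ => hnonneg d.1)
      (hasSum_finsupp_prod_of_support_subset hf hf0 hF (T.sup Finsupp.support))
    rw [Finset.sum_subtype_of_mem (fun d : ι →₀ M => d.prod f) hT] at h
    exact h.trans (hmono.ge_of_tendsto hP _)
  · refine le_of_tendsto' hP fun s => ?_
    refine hasSum_le_of_sum_le (hasSum_finsupp_prod_of_support_subset hf hf0 hF s) fun T => ?_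
    have h := hb ⟨T.map (Function.Embedding.subtype _), rfl⟩
    simpa using h

theorem hasSum_pow_natAbs {r : ℝ} (h0 : 0 ≤ r) (h1 : r < 1) :
    HasSum (fun n : ℤ => r ^ n.natAbs) ((1 - r ^ 2) / (1 - r) ^ 2) := by
  have hg := hasSum_geometric_of_lt_one h0 h1
  have hsum : HasSum (fun n : ℤ => r ^ n.natAbs) ((1 - r)⁻¹ + r * (1 - r)⁻¹) := by
    refine HasSum.of_nat_of_neg_add_one (by simpa using hg) ?_
    exact (funext fun n : ℕ => (pow_succ' r n).symm) ▸ hg.mul_left r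
  convert hsum using 1
  have : 1 - r ≠ 0 := by linarith
  field_simp
  ring

theorem multipliable_one_sub_sq_div {ι : Type*} {x : ι → ℝ} (h0 : ∀ a, 0 ≤ x a)
    (h1 : ∀ a, x a < 1) (hs : Summable x) :
    Multipliable fun a => (1 - x a ^ 2) / (1 - x a) ^ 2 := by
  have hsum : Summable fun a => 2 * x a / (1 - x a) := by
    refine (hs.mul_left 4).of_norm_bounded_eventually ?_
    filter_upwards [hs.tendsto_cofinite_zero.eventually_le_const one_half_pos] with a ha
    have h : 0 < 1 - x a := by linarith [h1 a]
    rw [Real.norm_of_nonneg (div_nonneg (by linarith [h0 a]) h.le), div_le_iff₀ h]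
    nlinarith [h0 a]
  convert Real.multipliable_one_add_of_summable hsum using 2 with a
  have : 1 - x a ≠ 0 := by linarith [h1 a]
  field_simp
  ring

/-- Proposition 2.13, abstractly: if `0 ≤ x a < 1` for all `a` and `x` is summable,
then `d ↦ ∏_a x a ^ |d a|` is summable over finitely supported `d : ι →₀ ℤ`, the
family `a ↦ (1 - x a²)/(1 - x a)²` is multipliable, and
`∑_{d : ι →₀ ℤ} ∏_a x a ^ |d a| = ∏_a (1 - x a²)/(1 - x a)²`. -/
theorem stmt8 {ι : Type*} (x : ι → ℝ) (h0 : ∀ a, 0 ≤ x a) (h1 : ∀ a, x a < 1)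
    (hs : Summable x) :
    Summable (fun d : ι →₀ ℤ => d.prod fun a n => x a ^ n.natAbs) ∧
    Multipliable (fun a : ι => (1 - (x a) ^ 2) / (1 - x a) ^ 2) ∧
    ∑' d : ι →₀ ℤ, (d.prod fun a n => x a ^ n.natAbs) =
      ∏' a : ι, (1 - (x a) ^ 2) / (1 - x a) ^ 2 := by
  have hmul := multipliable_one_sub_sq_div h0 h1 hs
  have hsum := hasSum_finsupp_prod_of_hasProd (f := fun a (n : ℤ) => x a ^ n.natAbs)
    (fun a n => pow_nonneg (h0 a) _) (fun a => by simp)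
    (fun a => hasSum_pow_natAbs (h0 a) (h1 a)) hmul.hasProd
  exact ⟨hsum.summable, hmul, hsum.tsum_eq⟩
end

section
/- For every real β > 1, the family indexed by positive rational numbers r sending r to (num(r) · den(r))^{−β} is summable, and ∑_{r ∈ ℚ, r > 0} (num(r) · den(r))^{−β} = (∑_{n≥1} n^{−β})² / (∑_{n≥1} n^{−2β}), i.e. the sum equals ζ(β)²/ζ(2β). -/
/-- A pair of positive integers is a positive rational in lowest terms together with
the greatest common divisor of the pair. -/
lemma bijective_num_mul_den_mul : Function.Bijective
    (fun p : {r : ℚ // 0 < r} × ℕ+ =>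
      ((⟨p.1.1.num.toNat * p.2, Nat.mul_pos (by have := Rat.num_pos.2 p.1.2; lia) p.2.pos⟩,
        ⟨p.1.1.den * p.2, Nat.mul_pos p.1.1.den_pos p.2.pos⟩) : ℕ+ × ℕ+)) := by
  constructor
  · rintro ⟨⟨r, hr⟩, d⟩ ⟨⟨s, hs⟩, e⟩ h
    have h1 : r.num.toNat * (d : ℕ) = s.num.toNat * e := congrArg (fun q => (q.1 : ℕ)) h
    have h2 : r.den * (d : ℕ) = s.den * e := congrArg (fun q => (q.2 : ℕ)) h
    have hrn : ((r.num.toNat : ℤ) : ℚ) = r.num := by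
      rw [Int.toNat_of_nonneg (Rat.num_pos.2 hr).le]
    have hsn : ((s.num.toNat : ℤ) : ℚ) = s.num := by
      rw [Int.toNat_of_nonneg (Rat.num_pos.2 hs).le]
    have h1q : (r.num : ℚ) * (d : ℕ) = s.num * (e : ℕ) := by
      rw [← hrn, ← hsn]; exact_mod_cast h1
    have h2q : (r.den : ℚ) * (d : ℕ) = s.den * (e : ℕ) := by exact_mod_cast h2
    have hd : ((d : ℕ) : ℚ) ≠ 0 := by exact_mod_cast d.ne_zero
    have he : ((e : ℕ) : ℚ) ≠ 0 := by exact_mod_cast e.ne_zero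
    have hrs : r = s := by
      rw [← Rat.num_div_den r, ← Rat.num_div_den s, ← mul_div_mul_right _ _ hd, h1q, h2q,
        mul_div_mul_right _ _ he]
    subst hrs
    have : (d : ℕ) = e := Nat.eq_of_mul_eq_mul_left r.den_pos h2
    simp [PNat.coe_inj.1 this]
  · rintro ⟨a, b⟩
    obtain ⟨c, hca, hcb⟩ := Rat.exists_eq_mul_div_num_and_eq_mul_div_den ((a : ℕ) : ℤ)
      (d := ((b : ℕ) : ℤ)) (by exact_mod_cast b.ne_zero)
    set r : ℚ := (((a : ℕ) : ℤ) : ℚ) / (((b : ℕ) : ℤ) : ℚ) with hrdef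
    have hr : 0 < r := div_pos (by exact_mod_cast a.pos) (by exact_mod_cast b.pos)
    have hc : 0 < c := by
      have hb : (0 : ℤ) < (b : ℕ) := by exact_mod_cast b.pos
      rw [hcb] at hb
      exact pos_of_mul_pos_left hb (by positivity)
    have hn := (Rat.num_pos.2 hr).le
    refine ⟨(⟨r, hr⟩, ⟨c.toNat, by lia⟩), ?_⟩
    refine Prod.ext (PNat.eq ?_) (PNat.eq ?_)
    · change r.num.toNat * c.toNat = a
      zify
      rw [Int.toNat_of_nonneg hn, Int.toNat_of_nonneg hc.le, mul_comm]
      exact hca.symm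
    · change r.den * c.toNat = b
      zify
      rw [Int.toNat_of_nonneg hc.le, mul_comm]
      exact hcb.symm

lemma tsum_pnat_rpow_neg {s : ℝ} (hs : 0 < s) :
    ∑' n : ℕ+, ((n : ℕ) : ℝ) ^ (-s) = ∑' n : ℕ, (n : ℝ) ^ (-s) := by
  refine Function.Injective.tsum_eq (f := fun n : ℕ => (n : ℝ) ^ (-s)) PNat.coe_injective ?_
  intro n hn
  rcases Nat.eq_zero_or_pos n with rfl | h
  · simp [Real.zero_rpow (neg_ne_zero.2 hs.ne')] at hn
  · exact ⟨⟨n, h⟩, rfl⟩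

lemma summable_pnat_rpow_neg {s : ℝ} (hs : 1 < s) :
    Summable (fun n : ℕ+ => ((n : ℕ) : ℝ) ^ (-s)) :=
  (Real.summable_nat_rpow.2 (neg_lt_neg hs)).comp_injective PNat.coe_injective

/-- Lemma 2.11: for real `β > 1`, the family `r ↦ (num(r)·den(r))^{-β}` over
positive rationals is summable, with sum `ζ(β)²/ζ(2β)`, where
`ζ(s) = ∑_{n≥1} n^{-s}`. -/
theorem stmt9 (β : ℝ) (hβ : 1 < β) :
    Summable (fun r : {r : ℚ // 0 < r} => ((r.1.num : ℝ) * (r.1.den : ℝ)) ^ (-β)) ∧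
    ∑' r : {r : ℚ // 0 < r}, ((r.1.num : ℝ) * (r.1.den : ℝ)) ^ (-β) =
      (∑' n : ℕ, (n : ℝ) ^ (-β)) ^ 2 / ∑' n : ℕ, (n : ℝ) ^ (-(2 * β)) := by
  have hg := summable_pnat_rpow_neg hβ
  have hh := summable_pnat_rpow_neg (s := 2 * β) (by linarith)
  have hprod := hg.mul_of_nonneg hg (fun n => by positivity) (fun n => by positivity)
  have hsq := hg.tsum_mul_tsum hg hprod
  let e := Equiv.ofBijective _ bijective_num_mul_den_mul
  have key (p : {r : ℚ // 0 < r} × ℕ+) :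
      (((e p).1 : ℕ) : ℝ) ^ (-β) * (((e p).2 : ℕ) : ℝ) ^ (-β) =
        ((p.1.1.num : ℝ) * (p.1.1.den : ℝ)) ^ (-β) * ((p.2 : ℕ) : ℝ) ^ (-(2 * β)) := by
    obtain ⟨⟨r, hr⟩, d⟩ := p
    have hn := Rat.num_pos.2 hr
    have hnR : (0 : ℝ) < r.num := by exact_mod_cast hn
    have hcast : (r.num.toNat : ℝ) = r.num := by
      exact_mod_cast congrArg (Int.cast : ℤ → ℝ) (Int.toNat_of_nonneg hn.le)
    have hd : (0 : ℝ) < (d : ℕ) := by exact_mod_cast d.pos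
    have hsplit : ((d : ℕ) : ℝ) ^ (-(2 * β)) = (d : ℕ) ^ (-β) * (d : ℕ) ^ (-β) := by
      rw [← Real.rpow_add hd]; ring_nf
    simp only [e, Equiv.ofBijective_apply, PNat.mk_coe, Nat.cast_mul, hcast]
    rw [hsplit, Real.mul_rpow hnR.le hd.le, Real.mul_rpow (by positivity) hd.le,
      Real.mul_rpow hnR.le (by positivity)]
    ring
  have hF2 : Summable (fun p : {r : ℚ // 0 < r} × ℕ+ =>
      ((p.1.1.num : ℝ) * (p.1.1.den : ℝ)) ^ (-β) * ((p.2 : ℕ) : ℝ) ^ (-(2 * β))) :=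
    (e.summable_iff.2 hprod).congr key
  have hF : Summable (fun r : {r : ℚ // 0 < r} =>
      ((r.1.num : ℝ) * (r.1.den : ℝ)) ^ (-β)) := by
    simpa [Function.comp_def] using
      hF2.comp_injective (Prod.mk_left_injective (1 : ℕ+))
  refine ⟨hF, ?_⟩
  have hpos : 0 < ∑' n : ℕ+, ((n : ℕ) : ℝ) ^ (-(2 * β)) :=
    hh.tsum_pos (fun n => by positivity) 1 (by simp)
  rw [← tsum_pnat_rpow_neg (by linarith : 0 < β),
    ← tsum_pnat_rpow_neg (by linarith : 0 < 2 * β), eq_div_iff hpos.ne',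
    hF.tsum_mul_tsum hh hF2, sq, hsq, ← e.tsum_eq]
  exact tsum_congr fun p => (key p).symm
end

section
/- Fix a positive integer m₀ and for real s let ζ_{m₀}(s) = ∑_{n ≥ 1, gcd(n, m₀) = 1} n^{−s}. Let ι be a countable type, i₀ ∈ ι, and f : ι → ℕ a function with f(i₀) = 1, with f(i) ≥ 2 for every i ≠ i₀, and with ∑_{i} 1/f(i) < ∞. Then: (i) for every real β > 1, each series ζ_{m₀}(f(i)β) converges, and the family i ↦ ζ_{m₀}(f(i)β) is multipliable with product a finite positive real number; and (ii) for every real β with 0 < β ≤ 1, the series ζ_{m₀}(f(i₀)β) = ζ_{m₀}(β) diverges. -/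
/-- For `n ≥ 2` the terms of the Dirichlet series at `k * β` are smaller than those at `β` by a
factor at least `k`. -/
lemma natCast_rpow_neg_mul_le {n k : ℕ} {β : ℝ} (hn : 2 ≤ n) (hk : 1 ≤ k) (hβ : 1 ≤ β) :
    (n : ℝ) ^ (-((k : ℝ) * β)) ≤ (k : ℝ)⁻¹ * (n : ℝ) ^ (-β) := by
  obtain ⟨j, rfl⟩ := Nat.exists_eq_add_of_le' hk
  have hn0 : (0 : ℝ) < n := by positivity
  have hn1 : (1 : ℝ) ≤ n := by exact_mod_cast (by omega : 1 ≤ n)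
  have hpow : ((j + 1 : ℕ) : ℝ) ≤ (n : ℝ) ^ ((j : ℝ) * β) := by
    calc ((j + 1 : ℕ) : ℝ) ≤ (n : ℝ) ^ j := by
          exact_mod_cast (Nat.lt_pow_self (by omega : 1 < n) : j < n ^ j)
      _ = (n : ℝ) ^ (j : ℝ) := (Real.rpow_natCast _ _).symm
      _ ≤ (n : ℝ) ^ ((j : ℝ) * β) :=
          Real.rpow_le_rpow_of_exponent_le hn1 (le_mul_of_one_le_right (by positivity) hβ)
  have hsplit : -(((j + 1 : ℕ) : ℝ) * β) = -((j : ℝ) * β) + -β := by push_cast; ring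
  rw [hsplit, Real.rpow_add hn0, Real.rpow_neg hn0.le ((j : ℝ) * β)]
  gcongr

lemma summable_coprime_rpow_neg (m : ℕ) {s : ℝ} (hs : 1 < s) :
    Summable fun n : {n : ℕ // 0 < n ∧ Nat.gcd n m = 1} => ((n : ℕ) : ℝ) ^ (-s) :=
  (Real.summable_nat_rpow.mpr (neg_lt_neg hs)).subtype {n : ℕ | 0 < n ∧ Nat.gcd n m = 1}

lemma not_summable_coprime_rpow_neg {m : ℕ} (hm : 0 < m) {s : ℝ} (hs0 : 0 < s) (hs : s ≤ 1) :
    ¬ Summable fun n : {n : ℕ // 0 < n ∧ Nat.gcd n m = 1} => ((n : ℕ) : ℝ) ^ (-s) := by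
  intro h
  let e : ℕ → {n : ℕ // 0 < n ∧ Nat.gcd n m = 1} := fun k => ⟨m * k + 1, by omega, by simp⟩
  have he : Function.Injective e := fun a b hab =>
    Nat.eq_of_mul_eq_mul_left hm (Nat.succ_injective (congrArg Subtype.val hab))
  have hm' : (0 : ℝ) < (m : ℝ) ^ (-s) := by positivity
  have hsum : Summable fun k : ℕ => (m : ℝ) ^ (-s) * ((k + 1 : ℕ) : ℝ) ^ (-s) := by
    refine Summable.of_nonneg_of_le (fun k => by positivity) (fun k => ?_) (h.comp_injective he)
    rw [← Real.mul_rpow (by positivity) (by positivity)]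
    refine Real.rpow_le_rpow_of_nonpos (by simp only [e]; positivity) ?_ (by linarith)
    have : m * k + 1 ≤ m * (k + 1) := by rw [mul_add]; omega
    exact_mod_cast this
  rw [summable_mul_left_iff hm'.ne', summable_nat_add_iff 1 (f := fun k : ℕ => (k : ℝ) ^ (-s)),
    Real.summable_nat_rpow] at hsum
  linarith

/-- Removing the term `n = 1` from the Dirichlet series at `k * β` leaves a remainder of size
`O(1 / k)`. -/
lemma exists_tsum_coprime_rpow_neg_eq_one_add (m : ℕ) {k : ℕ} {β : ℝ} (hk : 1 ≤ k) (hβ : 1 < β) :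
    ∃ r : ℝ, 0 ≤ r ∧
      r ≤ (k : ℝ)⁻¹ * ∑' n : {n : ℕ // 0 < n ∧ Nat.gcd n m = 1}, ((n : ℕ) : ℝ) ^ (-β) ∧
      ∑' n : {n : ℕ // 0 < n ∧ Nat.gcd n m = 1}, ((n : ℕ) : ℝ) ^ (-((k : ℝ) * β)) = 1 + r := by
  classical
  have hk' : (1 : ℝ) ≤ k := by exact_mod_cast hk
  have hsum := summable_coprime_rpow_neg m (s := k * β) (by nlinarith)
  let one : {n : ℕ // 0 < n ∧ Nat.gcd n m = 1} := ⟨1, one_pos, Nat.gcd_one_left m⟩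
  have hle (n : {n : ℕ // 0 < n ∧ Nat.gcd n m = 1}) :
      (if n = one then 0 else ((n : ℕ) : ℝ) ^ (-((k : ℝ) * β))) ≤
        (k : ℝ)⁻¹ * ((n : ℕ) : ℝ) ^ (-β) := by
    split_ifs with h
    · positivity
    · have h1 : (n : ℕ) ≠ 1 := fun h' => h (Subtype.ext h')
      exact natCast_rpow_neg_mul_le (by have := n.2.1; omega) hk hβ.le
  have hnonneg (n : {n : ℕ // 0 < n ∧ Nat.gcd n m = 1}) :
      0 ≤ (if n = one then 0 else ((n : ℕ) : ℝ) ^ (-((k : ℝ) * β))) := by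
    split_ifs <;> positivity
  have hmaj := (summable_coprime_rpow_neg m hβ).mul_left (k : ℝ)⁻¹
  refine ⟨_, tsum_nonneg (L := .unconditional _) hnonneg, ?_, ?_⟩
  · rw [← tsum_mul_left]
    exact (Summable.of_nonneg_of_le hnonneg hle hmaj).tsum_le_tsum hle hmaj
  · rw [hsum.tsum_eq_add_tsum_ite one]
    simp [one]

/-- Proposition 5.12, abstractly: with `ζ_{m₀}(s) = ∑_{n ≥ 1, gcd(n,m₀)=1} n^{-s}`
and `f : ι → ℕ` with `f i₀ = 1`, `f i ≥ 2` for `i ≠ i₀`, and `∑ 1/f i < ∞`: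
for every `β > 1` each `ζ_{m₀}(f(i)β)` converges and the family
`i ↦ ζ_{m₀}(f(i)β)` is multipliable with positive product, while for
`0 < β ≤ 1` the series `ζ_{m₀}(f(i₀)β) = ζ_{m₀}(β)` diverges. -/
theorem stmt17 (m₀ : ℕ) (hm₀ : 0 < m₀) {ι : Type*} [Countable ι] (i₀ : ι)
    (f : ι → ℕ) (hf₀ : f i₀ = 1) (hf2 : ∀ i, i ≠ i₀ → 2 ≤ f i)
    (hfs : Summable fun i : ι => ((f i : ℝ))⁻¹) :
    (∀ β : ℝ, 1 < β →
      (∀ i : ι, Summable fun n : {n : ℕ // 0 < n ∧ Nat.gcd n m₀ = 1} =>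
        ((n : ℕ) : ℝ) ^ (-((f i : ℝ) * β))) ∧
      Multipliable (fun i : ι =>
        ∑' n : {n : ℕ // 0 < n ∧ Nat.gcd n m₀ = 1},
          ((n : ℕ) : ℝ) ^ (-((f i : ℝ) * β))) ∧
      0 < ∏' i : ι, ∑' n : {n : ℕ // 0 < n ∧ Nat.gcd n m₀ = 1},
          ((n : ℕ) : ℝ) ^ (-((f i : ℝ) * β))) ∧
    (∀ β : ℝ, 0 < β → β ≤ 1 →
      ¬ Summable fun n : {n : ℕ // 0 < n ∧ Nat.gcd n m₀ = 1} =>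
        ((n : ℕ) : ℝ) ^ (-((f i₀ : ℝ) * β))) := by
  have hf1 (i : ι) : 1 ≤ f i := by
    rcases eq_or_ne i i₀ with rfl | h
    · exact hf₀.ge
    · exact one_le_two.trans (hf2 i h)
  refine ⟨fun β hβ => ⟨fun i => ?_, ?_⟩, fun β hβ0 hβ => ?_⟩
  · have : (1 : ℝ) ≤ f i := by exact_mod_cast hf1 i
    exact summable_coprime_rpow_neg m₀ (by nlinarith)
  · choose r hr0 hrle hr using fun i =>
      exists_tsum_coprime_rpow_neg_eq_one_add m₀ (hf1 i) hβ
    have hrs : Summable r := Summable.of_nonneg_of_le hr0 hrle (hfs.mul_right _)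
    have hpos (i : ι) : 0 < 1 + r i := by linarith [hr0 i]
    simp only [hr]
    refine ⟨Real.multipliable_one_add_of_summable hrs, ?_⟩
    rw [← Real.rexp_tsum_eq_tprod hpos (Real.summable_log_one_add_of_summable hrs)]
    exact Real.exp_pos _
  · simpa [hf₀] using not_summable_coprime_rpow_neg hm₀ hβ0 hβ
end

section
/- Let ι be a countable type, w : ι → ℕ a function with w(a) ≥ 1 for all a, and Q an integer with Q ≥ 2, such that ∑_{a} Q^{−w(a)} < ∞. Define f on finitely supported functions d : ι → ℤ by f(d) = Q^{∑_a |d(a)|·w(a)}. Then: (i) f(d) = 1 if and only if d = 0; (ii) f(d) ≥ 2 for every d ≠ 0; and (iii) ∑_{d : ι →₀ ℤ} 1/f(d) < ∞. -/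
open Finset in
/-- A two-sided geometric sum with ratio at most `1 / 2` is bounded by `1 + 4 * x`. -/
lemma sum_pow_natAbs_le {x : ℝ} (hx0 : 0 ≤ x) (hx : x ≤ 1 / 2) (F : Finset ℤ) :
    ∑ k ∈ F, x ^ k.natAbs ≤ 1 + 4 * x := by
  have hx1 : x < 1 := by linarith
  have hgeo := hasSum_geometric_of_lt_one hx0 hx1
  have hneg : HasSum (fun n : ℕ => x ^ (-((n : ℤ) + 1)).natAbs) (x * (1 - x)⁻¹) := by
    have hfun : (fun n : ℕ => x ^ (-((n : ℤ) + 1)).natAbs) = fun n => x * x ^ n := by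
      funext n
      rw [← pow_succ', show (-((n : ℤ) + 1)).natAbs = n + 1 by omega]
    exact hfun ▸ hgeo.mul_left x
  have hint : HasSum (fun k : ℤ => x ^ k.natAbs) ((1 - x)⁻¹ + x * (1 - x)⁻¹) :=
    HasSum.of_nat_of_neg_add_one (f := fun k : ℤ => x ^ k.natAbs) (by simpa using hgeo) hneg
  refine (sum_le_hasSum F (fun k _ => by positivity) hint).trans ?_
  have hpos : 0 < 1 - x := by linarith
  rw [show (1 - x)⁻¹ + x * (1 - x)⁻¹ = (1 + x) / (1 - x) by field_simp, div_le_iff₀ hpos]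
  nlinarith

open Finset in
/-- If `x` is summable with values in `[0, 1 / 2]`, then `d ↦ ∏ a, x a ^ |d a|` is summable
over the finitely supported integer-valued functions. -/
lemma summable_finsupp_prod_pow_natAbs {ι : Type*} {x : ι → ℝ} (hx0 : ∀ a, 0 ≤ x a)
    (hx : ∀ a, x a ≤ 1 / 2) (hs : Summable x) :
    Summable fun d : ι →₀ ℤ => d.prod fun a k => x a ^ k.natAbs := by
  classical
  refine summable_of_sum_le (c := Real.exp (4 * ∑' a, x a))
    (fun d => prod_nonneg fun a _ => pow_nonneg (hx0 a) _) fun T => ?_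
  set S : Finset ι := T.biUnion Finsupp.support
  have hS : ∀ d ∈ T, d.support ⊆ S := fun d hd => subset_biUnion_of_mem Finsupp.support hd
  let F : ι → Finset ℤ := fun a => T.image fun d => d a
  let r : (ι →₀ ℤ) → ∀ a ∈ S, ℤ := fun d a _ => d a
  have hr : Set.InjOn r T := by
    intro d hd e he h
    ext a
    by_cases ha : a ∈ S
    · exact congrFun (congrFun h a) ha
    · rw [Finsupp.notMem_support_iff.mp fun h' => ha (hS d hd h'),
        Finsupp.notMem_support_iff.mp fun h' => ha (hS e he h')]
  calc ∑ d ∈ T, d.prod (fun a k => x a ^ k.natAbs)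
      = ∑ d ∈ T, ∏ a ∈ S.attach, x a ^ (r d a a.2).natAbs := by
        refine sum_congr rfl fun d hd => ?_
        rw [Finsupp.prod_of_support_subset d (hS d hd) _ (by simp)]
        exact (prod_attach S fun a => x a ^ (d a).natAbs).symm
    _ = ∑ p ∈ T.image r, ∏ a ∈ S.attach, x a ^ (p a a.2).natAbs :=
        (sum_image (f := fun p : ∀ a ∈ S, ℤ => ∏ a ∈ S.attach, x a ^ (p a a.2).natAbs) hr).symm
    _ ≤ ∑ p ∈ S.pi F, ∏ a ∈ S.attach, x a ^ (p a a.2).natAbs := by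
        refine sum_le_sum_of_subset_of_nonneg ?_
          fun p _ _ => prod_nonneg fun a _ => pow_nonneg (hx0 a) _
        intro p hp
        obtain ⟨d, hd, rfl⟩ := mem_image.mp hp
        exact mem_pi.mpr fun a _ => mem_image_of_mem (fun d : ι →₀ ℤ => d a) hd
    _ = ∏ a ∈ S, ∑ k ∈ F a, x a ^ k.natAbs :=
        (prod_sum S F fun a k => x a ^ k.natAbs).symm
    _ ≤ ∏ a ∈ S, Real.exp (4 * x a) := by
        refine prod_le_prod (fun a _ => sum_nonneg fun k _ => pow_nonneg (hx0 a) _) fun a _ => ?_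
        linarith [sum_pow_natAbs_le (hx0 a) (hx a) (F a), Real.add_one_le_exp (4 * x a)]
    _ = Real.exp (4 * ∑ a ∈ S, x a) := by rw [← Real.exp_sum, mul_sum]
    _ ≤ Real.exp (4 * ∑' a, x a) := by
        gcongr
        exact hs.sum_le_tsum S fun a _ => hx0 a


/-- Proposition 5.16, abstractly: for weights `w : ι → ℕ` with `w a ≥ 1`, an
integer `Q ≥ 2` with `∑_a Q^{-w(a)} < ∞`, the function
`f(d) = Q^{∑_a |d a|·w a}` on the free abelian group `ι →₀ ℤ` satisfies
`f(d) = 1` iff `d = 0`, `f(d) ≥ 2` for `d ≠ 0`, and `∑_d 1/f(d) < ∞`. -/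
theorem stmt18 {ι : Type*} [Countable ι] (w : ι → ℕ) (hw : ∀ a, 1 ≤ w a)
    (Q : ℕ) (hQ : 2 ≤ Q) (hs : Summable fun a : ι => ((Q : ℝ) ^ (w a))⁻¹) :
    (∀ d : ι →₀ ℤ, Q ^ (d.sum fun a k => k.natAbs * w a) = 1 ↔ d = 0) ∧
    (∀ d : ι →₀ ℤ, d ≠ 0 → 2 ≤ Q ^ (d.sum fun a k => k.natAbs * w a)) ∧
    Summable (fun d : ι →₀ ℤ =>
      ((Q : ℝ) ^ (d.sum fun a k => k.natAbs * w a))⁻¹) := by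
  have hexp : ∀ d : ι →₀ ℤ, d ≠ 0 → (d.sum fun a k => k.natAbs * w a) ≠ 0 := by
    intro d hd h
    obtain ⟨a, ha⟩ := Finsupp.support_nonempty_iff.mpr hd
    have hterm := Finset.sum_eq_zero_iff.mp h a ha
    have hda := Finsupp.mem_support_iff.mp ha
    rcases Nat.mul_eq_zero.mp hterm with h0 | h0
    · exact hda (Int.natAbs_eq_zero.mp h0)
    · exact Nat.one_le_iff_ne_zero.mp (hw a) h0
  have htwo : ∀ d : ι →₀ ℤ, d ≠ 0 → 2 ≤ Q ^ (d.sum fun a k => k.natAbs * w a) :=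
    fun d hd => hQ.trans (Nat.le_self_pow (hexp d hd) Q)
  refine ⟨fun d => ⟨fun h => ?_, fun h => by simp [h]⟩, htwo, ?_⟩
  · by_contra hd
    have := htwo d hd
    omega
  · have hQ' : (2 : ℝ) ≤ Q := by exact_mod_cast hQ
    have hhalf : ∀ a, ((Q : ℝ) ^ w a)⁻¹ ≤ 1 / 2 := fun a => by
      rw [one_div]
      exact inv_anti₀ two_pos
        (hQ'.trans (le_self_pow₀ (by linarith) (Nat.one_le_iff_ne_zero.mp (hw a))))
    refine (summable_finsupp_prod_pow_natAbs (fun a => by positivity) hhalf hs).congr fun d => ?_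
    simp only [Finsupp.prod, Finsupp.sum, ← Finset.prod_pow_eq_pow_sum, ← Finset.prod_inv_distrib]
    refine Finset.prod_congr rfl fun a _ => ?_
    rw [inv_pow, ← pow_mul, mul_comm]
end
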